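/- Let a ∈ (0,1), δ ∈ [0,1), let (u_n) be a δ-sublacunary sequence of positive reals with u_1 ≥ 1, and (I_n) intervals in [0,1] with λ(I_n) = n^{-a}. Set X_n(y) = 1_{I_n}(frac(u_n y)), σ_n = E(X_n), and Y_n = X_n − σ_n. Then there is a constant C such that for all n₁ < n₂ < n₃ < n₄, |E(Y_{n₁}Y_{n₂}Y_{n₃}Y_{n₄})| ≤ C [ n₃^{-a} n₂^{-a} (1/u_{n₁} + u_{n₁}/u_{n₂} + u_{n₂}/u_{n₃}) + n₃^{-a} (u_{n₃}/u_{n₄}) (n₁^{-a} + 1/u_{n₁} + u_{n₂}/u_{n₃}) ]. -/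

import Mathlib

open MeasureTheory Filter

/-- The indicator random variable `X_n(y) = 1_{I_n}(frac(u_n y))`. -/
noncomputable def Xv (u : ℕ → ℝ) (I : ℕ → Set ℝ) (n : ℕ) (y : ℝ) : ℝ :=
  (I n).indicator (fun _ => (1:ℝ)) (Int.fract (u n * y))

/-- The centered variable `Y_n = X_n − E(X_n)`. -/
noncomputable def Yv (u : ℕ → ℝ) (I : ℕ → Set ℝ) (n : ℕ) (y : ℝ) : ℝ :=
  Xv u I n y - ∫ z in Set.Icc (0:ℝ) 1, Xv u I n z

/-- The integrals of `f` over the subintervals of `[0, 1]` of length `ℓ` are at most `A + B * ℓ`. -/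
def HasIntegralBound (f : ℝ → ℝ) (A B : ℝ) : Prop :=
  ∀ s t : ℝ, 0 ≤ s → s ≤ t → t ≤ 1 → |∫ y in s..t, f y| ≤ A + B * (t - s)

/-- The indicator of `{y | frac(v y) ∈ [p, q]}`. -/
noncomputable def fractIndicator (v p q y : ℝ) : ℝ :=
  (Set.Icc p q).indicator (fun _ => (1 : ℝ)) (Int.fract (v * y))

lemma fractIndicator_nonneg (v p q y : ℝ) : 0 ≤ fractIndicator v p q y :=
  Set.indicator_nonneg (fun _ _ => zero_le_one) _

lemma fractIndicator_le_one (v p q y : ℝ) : fractIndicator v p q y ≤ 1 :=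
  Set.indicator_le_self' (f := fun _ => (1 : ℝ)) (fun _ _ => zero_le_one) _

lemma abs_fractIndicator_mul_le (v p q y : ℝ) {x M : ℝ} (hx : |x| ≤ M) :
    |fractIndicator v p q y * x| ≤ M := by
  rw [abs_mul, abs_of_nonneg (fractIndicator_nonneg v p q y)]
  exact (mul_le_of_le_one_left (abs_nonneg _) (fractIndicator_le_one v p q y)).trans hx

lemma measurable_fractIndicator (v p q : ℝ) : Measurable (fractIndicator v p q) :=
  (measurable_const.indicator measurableSet_Icc).comp
    (measurable_fract.comp (measurable_const.mul measurable_id))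

lemma intervalIntegrable_of_bounded {f : ℝ → ℝ} {M : ℝ} (hf : Measurable f)
    (hM : ∀ y, |f y| ≤ M) (s t : ℝ) : IntervalIntegrable f volume s t :=
  (intervalIntegrable_const (c := M)).mono_fun hf.aestronglyMeasurable
    (Eventually.of_forall fun y => by
      simpa using (hM y).trans (le_abs_self M))

lemma intervalIntegrable_fractIndicator (v p q s t : ℝ) :
    IntervalIntegrable (fractIndicator v p q) volume s t :=
  intervalIntegrable_of_bounded (M := 1) (measurable_fractIndicator v p q)
    (fun y => abs_le.2 ⟨by linarith [fractIndicator_nonneg v p q y],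
      fractIndicator_le_one v p q y⟩) s t

lemma integral_fractIndicator_one_unit {p q : ℝ} (hp : 0 ≤ p) (hpq : p ≤ q) (hq : q ≤ 1) :
    ∫ y in (0 : ℝ)..1, fractIndicator 1 p q y = q - p := by
  have h : ∫ y in (0 : ℝ)..1, fractIndicator 1 p q y
      = ∫ y in (0 : ℝ)..1, (Set.Icc p q).indicator (fun _ => (1 : ℝ)) y := by
    rw [intervalIntegral.integral_of_le zero_le_one, intervalIntegral.integral_of_le zero_le_one,
      integral_Ioc_eq_integral_Ioo, integral_Ioc_eq_integral_Ioo]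
    refine setIntegral_congr_fun measurableSet_Ioo fun y hy => ?_
    simp only [fractIndicator, one_mul, Int.fract_eq_self.2 ⟨hy.1.le, hy.2⟩]
  rw [h, intervalIntegral.integral_of_le zero_le_one, ← integral_Icc_eq_integral_Ioc,
    setIntegral_indicator measurableSet_Icc,
    Set.inter_eq_right.2 (Set.Icc_subset_Icc hp hq)]
  simp [hpq]

lemma fractIndicator_one_periodic (p q : ℝ) : Function.Periodic (fractIndicator 1 p q) 1 := by
  intro y
  simp [fractIndicator]

lemma abs_integral_fractIndicator_one_sub_le {p q : ℝ} (hp : 0 ≤ p) (hpq : p ≤ q) (hq : q ≤ 1)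
    (s t : ℝ) :
    |(∫ y in s..t, fractIndicator 1 p q y) - (q - p) * (t - s)| ≤ q - p := by
  have hint := intervalIntegrable_fractIndicator 1 p q
  have hnn := fractIndicator_nonneg 1 p q
  set N : ℤ := ⌊t - s⌋ with hN
  have hN1 : (N : ℝ) ≤ t - s := Int.floor_le _
  have hN2 : t - s < N + 1 := Int.lt_floor_add_one _
  have hunit (x : ℝ) : ∫ y in x..x + 1, fractIndicator 1 p q y = q - p := by
    rw [(fractIndicator_one_periodic p q).intervalIntegral_add_eq x 0, zero_add,
      integral_fractIndicator_one_unit hp hpq hq]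
  have hfull : ∫ y in s..s + N, fractIndicator 1 p q y = N * (q - p) := by
    have := (fractIndicator_one_periodic p q).intervalIntegral_add_zsmul_eq N s hint
    rw [hunit] at this
    simpa using this
  have hsplit := intervalIntegral.integral_add_adjacent_intervals (hint s (s + N)) (hint (s + N) t)
  have hlow : 0 ≤ ∫ y in s + N..t, fractIndicator 1 p q y :=
    intervalIntegral.integral_nonneg (by linarith) fun y _ => hnn y
  have hupp : ∫ y in s + N..t, fractIndicator 1 p q y ≤ q - p := by
    rw [← hunit (s + N)]
    exact intervalIntegral.integral_mono_interval le_rfl (by linarith) (by linarith)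
      (Eventually.of_forall hnn) (hint _ _)
  rw [← hsplit, hfull, abs_le]
  constructor <;> nlinarith [sub_nonneg.2 hpq]

lemma abs_integral_fractIndicator_sub_le {v p q : ℝ} (hv : 0 < v) (hp : 0 ≤ p) (hpq : p ≤ q)
    (hq : q ≤ 1) (s t : ℝ) :
    |(∫ y in s..t, fractIndicator v p q y) - (q - p) * (t - s)| ≤ (q - p) / v := by
  have h : ∫ y in s..t, fractIndicator v p q y
      = v⁻¹ * ∫ y in v * s..v * t, fractIndicator 1 p q y := by
    rw [← smul_eq_mul, ← intervalIntegral.integral_comp_mul_left _ hv.ne']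
    simp [fractIndicator]
  have h1 := abs_integral_fractIndicator_one_sub_le hp hpq hq (v * s) (v * t)
  have h2 : (∫ y in s..t, fractIndicator v p q y) - (q - p) * (t - s)
      = v⁻¹ * ((∫ y in v * s..v * t, fractIndicator 1 p q y) - (q - p) * (v * t - v * s)) := by
    rw [h]
    field_simp
  rw [h2, abs_mul, abs_of_pos (inv_pos.2 hv), inv_mul_eq_div]
  gcongr

/-- On a single period, `fractIndicator` cuts out one interval of length at most `(q - p) / v`. -/
lemma HasIntegralBound.abs_integral_fractIndicator_mul_le_of_period {f : ℝ → ℝ} {A B v p q : ℝ}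
    (h : HasIntegralBound f A B) (hA : 0 ≤ A) (hB : 0 ≤ B) (hv : 0 < v) (hpq : p ≤ q)
    {k : ℤ} {s t : ℝ} (hs : 0 ≤ s) (hst : s ≤ t) (ht : t ≤ 1) (hks : k ≤ v * s)
    (hkt : v * t ≤ k + 1) :
    |∫ y in s..t, fractIndicator v p q y * f y| ≤ A + B * ((q - p) / v) := by
  set l := (k + p) / v
  set r := (k + q) / v
  have hlr : r - l = (q - p) / v := by simp only [l, r]; ring
  have hD : 0 ≤ A + B * ((q - p) / v) := by
    have := sub_nonneg.2 hpq
    positivity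
  have heq : ∫ y in s..t, fractIndicator v p q y * f y
      = ∫ y in Set.Icc (max s l) (min t r), f y := by
    rw [intervalIntegral.integral_of_le hst, integral_Ioc_eq_integral_Ioo,
      ← Set.Icc_inter_Icc, ← setIntegral_indicator measurableSet_Icc,
      integral_Icc_eq_integral_Ioc, integral_Ioc_eq_integral_Ioo]
    refine setIntegral_congr_fun measurableSet_Ioo fun y hy => ?_
    have h1 : v * s < v * y := mul_lt_mul_of_pos_left hy.1 hv
    have h2 : v * y < v * t := mul_lt_mul_of_pos_left hy.2 hv
    have hfl : ⌊v * y⌋ = k := Int.floor_eq_iff.2 ⟨by linarith, by linarith⟩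
    have hmem : Int.fract (v * y) ∈ Set.Icc p q ↔ y ∈ Set.Icc l r := by
      rw [Int.fract, hfl, Set.mem_Icc, Set.mem_Icc, div_le_iff₀ hv, le_div_iff₀ hv]
      constructor <;> rintro ⟨_, _⟩ <;> constructor <;> linarith
    by_cases hy' : y ∈ Set.Icc l r
    · simp [fractIndicator, Set.indicator_of_mem hy', Set.indicator_of_mem (hmem.2 hy')]
    · simp [fractIndicator, Set.indicator_of_notMem hy',
        Set.indicator_of_notMem (fun h => hy' (hmem.1 h))]
  rw [heq]
  rcases le_or_gt (max s l) (min t r) with hle | hlt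
  · rw [integral_Icc_eq_integral_Ioc, ← intervalIntegral.integral_of_le hle]
    refine (h _ _ (hs.trans (le_max_left _ _)) hle ((min_le_left _ _).trans ht)).trans ?_
    gcongr
    rw [← hlr]
    exact sub_le_sub (min_le_right _ _) (le_max_right _ _)
  · rw [Set.Icc_eq_empty (not_le.2 hlt)]
    simpa using hD

lemma HasIntegralBound.fractIndicator_mul {f : ℝ → ℝ} {A B v p q M : ℝ}
    (h : HasIntegralBound f A B) (hf : Measurable f) (hM : ∀ y, |f y| ≤ M)
    (hA : 0 ≤ A) (hB : 0 ≤ B) (hv : 0 < v) (hpq : p ≤ q) :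
    HasIntegralBound (fun y => fractIndicator v p q y * f y)
      (2 * (A + B * ((q - p) / v))) (v * (A + B * ((q - p) / v))) := by
  set D := A + B * ((q - p) / v) with hD
  have hD0 : 0 ≤ D := by
    have := sub_nonneg.2 hpq
    positivity
  have hint : ∀ s t, IntervalIntegrable (fun y => fractIndicator v p q y * f y) volume s t :=
    intervalIntegrable_of_bounded (M := M) ((measurable_fractIndicator v p q).mul hf)
      fun y => abs_fractIndicator_mul_le v p q y (hM y)
  have key : ∀ (N : ℕ) (k : ℤ) (s t : ℝ), 0 ≤ s → s ≤ t → t ≤ 1 → k ≤ v * s →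
      v * t ≤ k + 1 + N → |∫ y in s..t, fractIndicator v p q y * f y| ≤ (N + 1) * D := by
    intro N
    induction N with
    | zero =>
      intro k s t hs hst ht hks hkt
      have := h.abs_integral_fractIndicator_mul_le_of_period hA hB hv hpq hs hst ht hks
        (by simpa using hkt)
      simpa using this
    | succ N ih =>
      intro k s t hs hst ht hks hkt
      push_cast at hkt ⊢
      rcases le_total (v * t) (k + 1) with hle | hle
      · have := h.abs_integral_fractIndicator_mul_le_of_period hA hB hv hpq hs hst ht hks hle
        have : 0 ≤ (N + 1) * D := by positivity
        linarith
      rcases le_total (v * s) (k + 1) with hle' | hle'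
      · set m := (k + 1) / v with hm
        have hvm : v * m = k + 1 := by rw [hm]; field_simp
        have hsm : s ≤ m := by rw [hm, le_div_iff₀ hv]; linarith
        have hmt : m ≤ t := by rw [hm, div_le_iff₀ hv]; linarith
        rw [← intervalIntegral.integral_add_adjacent_intervals (hint s m) (hint m t)]
        have h1 := h.abs_integral_fractIndicator_mul_le_of_period hA hB hv hpq hs hsm
          (hmt.trans ht) hks hvm.le
        have h2 := ih (k + 1) m t (hs.trans hsm) hmt ht (by push_cast; exact hvm.ge)
          (by push_cast; linarith)
        refine (abs_add_le _ _).trans ?_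
        linarith
      · have h2 := ih (k + 1) s t hs hst ht (by push_cast; exact hle') (by push_cast; linarith)
        linarith
  intro s t hs hst ht
  have h1 : (⌊v * s⌋ : ℝ) ≤ v * s := Int.floor_le _
  have h2 : v * s < ⌊v * s⌋ + 1 := Int.lt_floor_add_one _
  have h3 : v * s ≤ v * t := mul_le_mul_of_nonneg_left hst hv.le
  have h4 : (⌊v * t - ⌊v * s⌋⌋₊ : ℝ) ≤ v * t - ⌊v * s⌋ := Nat.floor_le (by linarith)
  have h5 := Nat.lt_floor_add_one (v * t - ⌊v * s⌋)
  refine (key ⌊v * t - ⌊v * s⌋⌋₊ ⌊v * s⌋ s t hs hst ht h1 (by linarith)).trans ?_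
  have : (⌊v * t - ⌊v * s⌋⌋₊ : ℝ) + 1 ≤ v * (t - s) + 2 := by linarith
  calc _ ≤ (v * (t - s) + 2) * D := by gcongr
    _ = _ := by ring

lemma HasIntegralBound.mono {f : ℝ → ℝ} {A B A' B' : ℝ} (h : HasIntegralBound f A B)
    (hA : A ≤ A') (hB : B ≤ B') : HasIntegralBound f A' B' := fun s t hs hst ht => by
  refine (h s t hs hst ht).trans ?_
  have := sub_nonneg.2 hst
  gcongr

lemma HasIntegralBound.centered_mul {f : ℝ → ℝ} {A B v p q M σ : ℝ}
    (h : HasIntegralBound f A B) (hf : Measurable f) (hM : ∀ y, |f y| ≤ M)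
    (hA : 0 ≤ A) (hB : 0 ≤ B) (hv : 0 < v) (hpq : p ≤ q)
    (hσ0 : 0 ≤ σ) (hσ : σ ≤ 2 * (q - p)) :
    HasIntegralBound (fun y => (fractIndicator v p q y - σ) * f y)
      (2 * (A + B * ((q - p) / v)) + 2 * (q - p) * A) (v * A + 3 * (q - p) * B) := by
  intro s t hs hst ht
  have h1 := h.fractIndicator_mul hf hM hA hB hv hpq s t hs hst ht
  have h2 := h s t hs hst ht
  have hint := intervalIntegrable_of_bounded hf hM s t
  have hint' : IntervalIntegrable (fun y => fractIndicator v p q y * f y) volume s t :=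
    intervalIntegrable_of_bounded (M := M) ((measurable_fractIndicator v p q).mul hf)
      (fun y => abs_fractIndicator_mul_le v p q y (hM y)) s t
  simp only [sub_mul]
  rw [intervalIntegral.integral_sub hint' (hint.const_mul σ), intervalIntegral.integral_const_mul]
  refine (abs_sub _ _).trans ?_
  rw [abs_mul, abs_of_nonneg hσ0]
  have h3 : σ * |∫ y in s..t, f y| ≤ 2 * (q - p) * (A + B * (t - s)) := by
    have := sub_nonneg.2 hpq
    gcongr
  have h4 : v * (B * ((q - p) / v)) = B * (q - p) := by field_simp
  have h5 : v * (A + B * ((q - p) / v)) = v * A + B * (q - p) := by rw [mul_add, h4]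
  rw [h5] at h1
  linarith

lemma hasIntegralBound_centered {v p q σ : ℝ} (hv : 0 < v) (hp : 0 ≤ p) (hpq : p ≤ q)
    (hq : q ≤ 1) (hσ : |σ - (q - p)| ≤ (q - p) / v) :
    HasIntegralBound (fun y => fractIndicator v p q y - σ) (2 * ((q - p) / v)) 0 := by
  intro s t hs hst ht
  have h1 := abs_integral_fractIndicator_sub_le hv hp hpq hq s t
  rw [intervalIntegral.integral_sub (intervalIntegrable_fractIndicator v p q s t) (by simp)]
  have h2 : |(σ - (q - p)) * (t - s)| ≤ (q - p) / v := by
    rw [abs_mul, abs_of_nonneg (sub_nonneg.2 hst)]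
    exact (mul_le_of_le_one_right (abs_nonneg _) (by linarith)).trans hσ
  have h3 : (∫ y in s..t, fractIndicator v p q y) - ∫ _ in s..t, σ
      = ((∫ y in s..t, fractIndicator v p q y) - (q - p) * (t - s))
        - (σ - (q - p)) * (t - s) := by
    simp only [intervalIntegral.integral_const, smul_eq_mul]
    ring
  rw [h3]
  refine (abs_sub _ _).trans ?_
  linarith

lemma abs_fractIndicator_sub_le (v p q y : ℝ) {σ : ℝ} (h0 : 0 ≤ σ) (h1 : σ ≤ 2) :
    |fractIndicator v p q y - σ| ≤ 2 := by
  have := fractIndicator_nonneg v p q y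
  have := fractIndicator_le_one v p q y
  exact abs_le.2 ⟨by linarith, by linarith⟩

/-- The mean of `fractIndicator` on `[0, 1]`. -/
noncomputable def fractMean (v p q : ℝ) : ℝ := ∫ y in (0 : ℝ)..1, fractIndicator v p q y

lemma fractMean_nonneg (v p q : ℝ) : 0 ≤ fractMean v p q :=
  intervalIntegral.integral_nonneg zero_le_one fun y _ => fractIndicator_nonneg v p q y

lemma abs_fractMean_sub_le {v p q : ℝ} (hv : 0 < v) (hp : 0 ≤ p) (hpq : p ≤ q) (hq : q ≤ 1) :
    |fractMean v p q - (q - p)| ≤ (q - p) / v := by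
  simpa [fractMean] using abs_integral_fractIndicator_sub_le hv hp hpq hq 0 1

lemma fractMean_le {v p q : ℝ} (hv : 1 ≤ v) (hp : 0 ≤ p) (hpq : p ≤ q) (hq : q ≤ 1) :
    fractMean v p q ≤ 2 * (q - p) := by
  have h := (abs_le.1 (abs_fractMean_sub_le (zero_lt_one.trans_le hv) hp hpq hq)).2
  have := div_le_self (sub_nonneg.2 hpq) hv
  linarith

/-- The centered version of `fractIndicator`. -/
noncomputable def centeredIndicator (v p q y : ℝ) : ℝ := fractIndicator v p q y - fractMean v p q

lemma measurable_centeredIndicator (v p q : ℝ) : Measurable (centeredIndicator v p q) :=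
  (measurable_fractIndicator v p q).sub measurable_const

lemma abs_centeredIndicator_le {v p q : ℝ} (hv : 1 ≤ v) (hp : 0 ≤ p) (hpq : p ≤ q) (hq : q ≤ 1)
    (y : ℝ) : |centeredIndicator v p q y| ≤ 2 :=
  abs_fractIndicator_sub_le v p q y (fractMean_nonneg v p q)
    ((fractMean_le hv hp hpq hq).trans (by linarith))

theorem abs_integral_four_centeredIndicator_le {v₁ v₂ v₃ v₄ p₁ p₂ p₃ p₄ q₁ q₂ q₃ q₄ : ℝ}
    (hv₁ : 1 ≤ v₁) (hv₁₂ : v₁ ≤ v₂) (hv₂₃ : v₂ ≤ v₃) (hv₃₄ : v₃ ≤ v₄)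
    (hp₁ : 0 ≤ p₁) (hp₂ : 0 ≤ p₂) (hp₃ : 0 ≤ p₃) (hp₄ : 0 ≤ p₄)
    (hpq₁ : p₁ ≤ q₁) (hpq₂ : p₂ ≤ q₂) (hpq₃ : p₃ ≤ q₃) (hpq₄ : p₄ ≤ q₄)
    (hq₁ : q₁ ≤ 1) (hq₂ : q₂ ≤ 1) (hq₃ : q₃ ≤ 1) (hq₄ : q₄ ≤ 1) (hl : q₂ - p₂ ≤ q₁ - p₁) :
    |∫ y in (0 : ℝ)..1, centeredIndicator v₁ p₁ q₁ y * (centeredIndicator v₂ p₂ q₂ y *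
      (centeredIndicator v₃ p₃ q₃ y * centeredIndicator v₄ p₄ q₄ y))|
      ≤ 200 * ((q₄ - p₄) / v₄) * (v₂ + v₃ * (q₁ - p₁)) := by
  have hv₂ : 1 ≤ v₂ := hv₁.trans hv₁₂
  have hv₃ : 1 ≤ v₃ := hv₂.trans hv₂₃
  have hv₄ : 1 ≤ v₄ := hv₃.trans hv₃₄
  have hm := measurable_centeredIndicator
  have b₂ := abs_centeredIndicator_le hv₂ hp₂ hpq₂ hq₂
  have b₃ := abs_centeredIndicator_le hv₃ hp₃ hpq₃ hq₃
  have b₄ := abs_centeredIndicator_le hv₄ hp₄ hpq₄ hq₄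
  have hm₃₄ := (hm v₃ p₃ q₃).mul (hm v₄ p₄ q₄)
  have hm₂₃₄ := (hm v₂ p₂ q₂).mul hm₃₄
  have b₃₄ (y : ℝ) : |centeredIndicator v₃ p₃ q₃ y * centeredIndicator v₄ p₄ q₄ y| ≤ 2 * 2 := by
    rw [abs_mul]
    exact mul_le_mul (b₃ y) (b₄ y) (abs_nonneg _) zero_le_two
  have b₂₃₄ (y : ℝ) : |centeredIndicator v₂ p₂ q₂ y *
      (centeredIndicator v₃ p₃ q₃ y * centeredIndicator v₄ p₄ q₄ y)| ≤ 2 * (2 * 2) := by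
    rw [abs_mul]
    exact mul_le_mul (b₂ y) (b₃₄ y) (abs_nonneg _) zero_le_two
  have hl₁ := sub_nonneg.2 hpq₁
  have hl₂ := sub_nonneg.2 hpq₂
  have hl₃ := sub_nonneg.2 hpq₃
  have hl₁' : q₁ - p₁ ≤ 1 := by linarith
  have hl₂' : q₂ - p₂ ≤ 1 := by linarith
  have hl₃' : q₃ - p₃ ≤ 1 := by linarith
  have hε : 0 ≤ (q₄ - p₄) / v₄ := div_nonneg (sub_nonneg.2 hpq₄) (by linarith)
  have hv₁0 : 0 < v₁ := by linarith
  have hv₂0 : 0 < v₂ := by linarith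
  have hv₃0 : 0 < v₃ := by linarith
  have hv₄0 : 0 < v₄ := by linarith
  have h₄ := hasIntegralBound_centered hv₄0 hp₄ hpq₄ hq₄
    (abs_fractMean_sub_le hv₄0 hp₄ hpq₄ hq₄)
  have hr : 200 * ((q₄ - p₄) / v₄) * (v₂ + v₃ * (q₁ - p₁))
      = 100 * (2 * ((q₄ - p₄) / v₄)) * (v₂ + v₃ * (q₁ - p₁)) := by ring
  rw [hr]
  have hε' : 0 ≤ 2 * ((q₄ - p₄) / v₄) := by positivity
  generalize 2 * ((q₄ - p₄) / v₄) = ε at h₄ hε'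
  have h₃ := (h₄.centered_mul (hm v₄ p₄ q₄) b₄ hε' le_rfl hv₃0 hpq₃
    (fractMean_nonneg v₃ p₃ q₃) (fractMean_le hv₃ hp₃ hpq₃ hq₃)).mono
    (A' := 4 * ε) (B' := v₃ * ε) (by nlinarith) (by linarith)
  have h₂ := (h₃.centered_mul hm₃₄ b₃₄ (by positivity) (by positivity) hv₂0 hpq₂
    (fractMean_nonneg v₂ p₂ q₂) (fractMean_le hv₂ hp₂ hpq₂ hq₂)).mono
    (A' := 16 * ε + 2 * (v₃ * ε * ((q₂ - p₂) / v₂)))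
    (B' := 4 * (v₂ * ε) + 3 * ((q₂ - p₂) * (v₃ * ε))) (by nlinarith) (by linarith)
  have h₁ := h₂.centered_mul hm₂₃₄ b₂₃₄ (by positivity) (by positivity) hv₁0 hpq₁
    (fractMean_nonneg v₁ p₁ q₁) (fractMean_le hv₁ hp₁ hpq₁ hq₁) 0 1 le_rfl zero_le_one le_rfl
  refine h₁.trans ?_
  clear h₁ h₂ h₃ h₄ hm₂₃₄ hm₃₄ b₂₃₄ b₃₄ b₂ b₃ b₄ hm hr
  have hd : (q₁ - p₁) / v₁ ≤ q₁ - p₁ := div_le_self hl₁ hv₁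
  have hd₂ : v₁ * ((q₂ - p₂) / v₂) ≤ q₁ - p₁ := by
    have : v₂ * ((q₂ - p₂) / v₂) = q₂ - p₂ := by field_simp
    have : v₁ * ((q₂ - p₂) / v₂) ≤ v₂ * ((q₂ - p₂) / v₂) := by gcongr
    linarith
  have hd₂0 : 0 ≤ (q₂ - p₂) / v₂ := by positivity
  generalize (q₁ - p₁) / v₁ = d₁ at *
  generalize (q₂ - p₂) / v₂ = d₂ at *
  generalize q₁ - p₁ = l₁ at *
  generalize q₂ - p₂ = l₂ at *
  have hA : v₁ * (16 * ε + 2 * (v₃ * ε * d₂)) ≤ 16 * (v₂ * ε) + 2 * (v₃ * l₁ * ε) := by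
    have e₁ : v₁ * ε ≤ v₂ * ε := by gcongr
    have e₂ : v₃ * ε * (v₁ * d₂) ≤ v₃ * ε * l₁ := by gcongr
    linarith
  have hB : l₁ * (4 * (v₂ * ε) + 3 * (l₂ * (v₃ * ε))) ≤ 4 * (v₂ * ε) + 3 * (v₃ * l₁ * ε) := by
    have e₁ : l₁ * (v₂ * ε) ≤ v₂ * ε := mul_le_of_le_one_left (by positivity) hl₁'
    have e₂ : l₂ * (v₃ * l₁ * ε) ≤ v₃ * l₁ * ε := mul_le_of_le_one_left (by positivity) hl₂'
    linarith
  have hA0 : 0 ≤ 16 * ε + 2 * (v₃ * ε * d₂) := by positivity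
  have hB0 : 0 ≤ 4 * (v₂ * ε) + 3 * (l₂ * (v₃ * ε)) := by positivity
  have hv₂ε : 0 ≤ v₂ * ε := by positivity
  have hv₃ε : 0 ≤ v₃ * l₁ * ε := by positivity
  generalize 16 * ε + 2 * (v₃ * ε * d₂) = A at *
  generalize 4 * (v₂ * ε) + 3 * (l₂ * (v₃ * ε)) = B at *
  have e₁ : A ≤ v₁ * A := le_mul_of_one_le_left hA0 hv₁
  have e₂ : l₁ * A ≤ A := mul_le_of_le_one_left hA0 hl₁'
  have e₃ : B * d₁ ≤ B * l₁ := by gcongr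
  linarith

lemma exists_Icc_eq_of_volume {J : Set ℝ} {ℓ : ℝ} (hℓ : 0 < ℓ) (hJ : J ⊆ Set.Icc 0 1)
    (hint : ∃ p q : ℝ, J = Set.Icc p q) (hvol : volume J = ENNReal.ofReal ℓ) :
    ∃ p q : ℝ, J = Set.Icc p q ∧ q - p = ℓ ∧ 0 ≤ p ∧ p ≤ q ∧ q ≤ 1 := by
  obtain ⟨p, q, rfl⟩ := hint
  rw [Real.volume_Icc] at hvol
  have hpq : 0 < q - p := ENNReal.ofReal_pos.1 (hvol ▸ ENNReal.ofReal_pos.2 hℓ)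
  have hle : p ≤ q := by linarith
  exact ⟨p, q, rfl, (ENNReal.ofReal_eq_ofReal_iff hpq.le hℓ.le).1 hvol,
    (hJ (Set.left_mem_Icc.2 hle)).1, hle, (hJ (Set.right_mem_Icc.2 hle)).2⟩

lemma Yv_eq_centeredIndicator {u : ℕ → ℝ} {I : ℕ → Set ℝ} {n : ℕ} {p q : ℝ}
    (h : I n = Set.Icc p q) : Yv u I n = centeredIndicator (u n) p q := by
  have hX : Xv u I n = fractIndicator (u n) p q := by
    funext y
    rw [Xv, h, fractIndicator]
  funext y
  rw [Yv, hX, centeredIndicator, fractMean, integral_Icc_eq_integral_Ioc,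
    intervalIntegral.integral_of_le zero_le_one]

/-- fourfold correlation bound for the centered indicators. -/
theorem fourfold_correlation_bound (a δ : ℝ) (ha : a ∈ Set.Ioo (0:ℝ) 1)
    (hδ : δ ∈ Set.Ico (0:ℝ) 1)
    (u : ℕ → ℝ) (hu : ∀ n, 0 < u n) (hu1 : 1 ≤ u 1)
    (c : ℝ) (hc : c ∈ Set.Ioo (0:ℝ) 1)
    (hsub : ∀ n : ℕ, 1 ≤ n → u (n + 1) / u n ≥ 1 + c * (n : ℝ) ^ (-δ))
    (I : ℕ → Set ℝ) (hIsub : ∀ n, I n ⊆ Set.Icc (0:ℝ) 1)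
    (hIint : ∀ n : ℕ, 1 ≤ n → ∃ p q : ℝ, I n = Set.Icc p q)
    (hIvol : ∀ n : ℕ, 1 ≤ n → volume (I n) = ENNReal.ofReal ((n:ℝ) ^ (-a))) :
    ∃ C : ℝ, 0 < C ∧ ∀ n₁ n₂ n₃ n₄ : ℕ, 1 ≤ n₁ → n₁ < n₂ → n₂ < n₃ → n₃ < n₄ →
      |∫ y in Set.Icc (0:ℝ) 1, Yv u I n₁ y * Yv u I n₂ y * Yv u I n₃ y * Yv u I n₄ y|
      ≤ C * ((n₃:ℝ) ^ (-a) * (n₂:ℝ) ^ (-a) * (1 / u n₁ + u n₁ / u n₂ + u n₂ / u n₃)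
          + (n₃:ℝ) ^ (-a) * (u n₃ / u n₄) * ((n₁:ℝ) ^ (-a) + 1 / u n₁ + u n₂ / u n₃)) := by
  have hstep : ∀ n : ℕ, 1 ≤ n → u n ≤ u (n + 1) := fun n hn => by
    have h := hsub n hn
    have h0 : 0 ≤ c * (n : ℝ) ^ (-δ) := mul_nonneg hc.1.le (Real.rpow_nonneg n.cast_nonneg _)
    exact (one_le_div (hu n)).1 (by linarith)
  have hmono : ∀ m n : ℕ, 1 ≤ m → m ≤ n → u m ≤ u n := fun m n hm hmn =>
    Nat.le_induction le_rfl (fun k hk ih => ih.trans (hstep k (hm.trans hk))) n hmn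
  have hI : ∀ n : ℕ, 1 ≤ n →
      ∃ p q : ℝ, I n = Set.Icc p q ∧ q - p = (n : ℝ) ^ (-a) ∧ 0 ≤ p ∧ p ≤ q ∧ q ≤ 1 :=
    fun n hn => exists_Icc_eq_of_volume (Real.rpow_pos_of_pos (by exact_mod_cast hn) _)
      (hIsub n) (hIint n hn) (hIvol n hn)
  have hlen : ∀ m n : ℕ, 1 ≤ m → m ≤ n → (n : ℝ) ^ (-a) ≤ (m : ℝ) ^ (-a) := fun m n hm hmn =>
    Real.rpow_le_rpow_of_nonpos (by exact_mod_cast hm) (by exact_mod_cast hmn)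
      (neg_nonpos.2 ha.1.le)
  refine ⟨200, by norm_num, fun n₁ n₂ n₃ n₄ h₁ h₁₂ h₂₃ h₃₄ => ?_⟩
  obtain ⟨p₁, q₁, hI₁, hl₁, hp₁, hpq₁, hq₁⟩ := hI n₁ h₁
  obtain ⟨p₂, q₂, hI₂, hl₂, hp₂, hpq₂, hq₂⟩ := hI n₂ (by omega)
  obtain ⟨p₃, q₃, hI₃, hl₃, hp₃, hpq₃, hq₃⟩ := hI n₃ (by omega)
  obtain ⟨p₄, q₄, hI₄, hl₄, hp₄, hpq₄, hq₄⟩ := hI n₄ (by omega)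
  have key := abs_integral_four_centeredIndicator_le (hu1.trans (hmono 1 n₁ le_rfl h₁))
    (hmono n₁ n₂ h₁ h₁₂.le) (hmono n₂ n₃ (by omega) h₂₃.le) (hmono n₃ n₄ (by omega) h₃₄.le)
    hp₁ hp₂ hp₃ hp₄ hpq₁ hpq₂ hpq₃ hpq₄ hq₁ hq₂ hq₃ hq₄
    (hl₂.trans_le ((hlen n₁ n₂ h₁ h₁₂.le).trans_eq hl₁.symm))
  rw [integral_Icc_eq_integral_Ioc, ← intervalIntegral.integral_of_le zero_le_one,
    Yv_eq_centeredIndicator hI₁, Yv_eq_centeredIndicator hI₂, Yv_eq_centeredIndicator hI₃,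
    Yv_eq_centeredIndicator hI₄]
  simp only [mul_assoc] at key ⊢
  refine key.trans ?_
  rw [hl₁, hl₄]
  have hu₁ := hu n₁
  have hu₂ := hu n₂
  have hu₃ := hu n₃
  have hu₄ := hu n₄
  have h₄₃ := hlen n₃ n₄ (by omega) h₃₄.le
  have hfirst : 0 ≤ (n₃ : ℝ) ^ (-a) *
      ((n₂ : ℝ) ^ (-a) * (1 / u n₁ + u n₁ / u n₂ + u n₂ / u n₃)) := by positivity
  have hinv : 0 ≤ 1 / u n₁ := by positivity
  calc _ = 200 * ((n₄ : ℝ) ^ (-a) * (u n₃ / u n₄ * ((n₁ : ℝ) ^ (-a) + u n₂ / u n₃))) := by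
        field_simp
        ring
    _ ≤ 200 * ((n₃ : ℝ) ^ (-a) *
        (u n₃ / u n₄ * ((n₁ : ℝ) ^ (-a) + 1 / u n₁ + u n₂ / u n₃))) := by
        gcongr
        linarith
    _ ≤ _ := by linarith
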